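/- Concavity of e_m^{1/m} on the Gårding cone: if x, y ∈ ℝ^n satisfy e_k(x) ≥ 0 and e_k(y) ≥ 0 for every k = 1,…,m, then for every t ∈ [0,1] one has e_m(t x + (1−t) y)^{1/m} ≥ t · e_m(x)^{1/m} + (1−t) · e_m(y)^{1/m}, where s^{1/m} denotes the nonnegative real m-th root. -/

import Mathlib

/-- The `k`-th elementary symmetric polynomial of the coordinates of `x ∈ ℝⁿ`
(with `esymm x 0 = 1`). -/
noncomputable def esymm {n : ℕ} (x : Fin n → ℝ) (k : ℕ) : ℝ :=
  ∑ S ∈ Finset.powersetCard k (Finset.univ : Finset (Fin n)), ∏ i ∈ S, x i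

open Polynomial
noncomputable def EE {ι : Type*} (s : Finset ι) (x : ι → ℝ) (k : ℕ) : ℝ :=
  ∑ S ∈ Finset.powersetCard k s, ∏ i ∈ S, x i

lemma EE_zero {ι : Type*} (s : Finset ι) (x : ι → ℝ) : EE s x 0 = 1 := by
  simp [EE]

lemma EE_insert {ι : Type*} [DecidableEq ι] (s : Finset ι) (i : ι) (hi : i ∉ s) (x : ι → ℝ) (k : ℕ) :
    EE (insert i s) x (k+1) = EE s x (k+1) + x i * EE s x k := by
  unfold EE
  rw [Finset.powersetCard_succ_insert hi, Finset.sum_union]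
  · congr 1
    rw [Finset.sum_image, Finset.mul_sum]
    · apply Finset.sum_congr rfl
      intro S hS
      rw [Finset.prod_insert]
      exact fun h => hi ((Finset.mem_powersetCard.1 hS).1 h)
    · intro S hS T hT h
      have h1 : i ∉ S := fun h => hi ((Finset.mem_powersetCard.1 hS).1 h)
      have h2 : i ∉ T := fun h => hi ((Finset.mem_powersetCard.1 hT).1 h)
      rw [← Finset.erase_insert h1, h, Finset.erase_insert h2]
  · rw [Finset.disjoint_left]
    intro S hS hS'
    obtain ⟨T, hT, rfl⟩ := Finset.mem_image.1 hS'
    exact hi ((Finset.mem_powersetCard.1 hS).1 (Finset.mem_insert_self _ _))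

lemma EE_erase {ι : Type*} [DecidableEq ι] (s : Finset ι) (i : ι) (hi : i ∈ s) (x : ι → ℝ) (k : ℕ) :
    EE s x (k+1) = EE (s.erase i) x (k+1) + x i * EE (s.erase i) x k := by
  rw [← EE_insert _ _ (Finset.notMem_erase i s), Finset.insert_erase hi]

lemma powersetCard_empty_succ {ι : Type*} (k : ℕ) : Finset.powersetCard (k+1) (∅ : Finset ι) = ∅ :=
  Finset.powersetCard_eq_empty.2 (by simp)

lemma EE_euler {ι : Type*} [DecidableEq ι] (s : Finset ι) (x : ι → ℝ) (k : ℕ) :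
    ∑ i ∈ s, x i * EE (s.erase i) x k = (k+1 : ℝ) * EE s x (k+1) := by
  induction s using Finset.induction_on generalizing k with
  | empty => simp [EE, powersetCard_empty_succ]
  | insert a s ha ih =>
    rw [Finset.sum_insert ha, Finset.erase_insert ha, EE_insert _ _ ha]
    have hne : ∀ i ∈ s, a ∉ s.erase i := fun i hi h => ha (Finset.mem_of_mem_erase h)
    have her : ∀ i ∈ s, (insert a s).erase i = insert a (s.erase i) := by
      intro i hi
      rw [Finset.erase_insert_of_ne]
      rintro rfl; exact ha hi
    cases k with
    | zero =>
      have := ih 0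
      simp only [EE_zero] at this ⊢
      rw [this]; push_cast; ring
    | succ k =>
      have : ∑ i ∈ s, x i * EE ((insert a s).erase i) x (k+1)
          = ∑ i ∈ s, x i * EE (s.erase i) x (k+1) + x a * ∑ i ∈ s, x i * EE (s.erase i) x k := by
        rw [Finset.mul_sum, ← Finset.sum_add_distrib]
        apply Finset.sum_congr rfl
        intro i hi
        rw [her i hi, EE_insert _ _ (hne i hi)]; ring
      rw [this, ih, ih]; push_cast; ring

lemma coeff_gen {ι : Type*} (s : Finset ι) (x : ι → ℝ) (k : ℕ) :
    (∏ i ∈ s, (1 + C (x i) * X) : ℝ[X]).coeff k = EE s x k := by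
  classical
  induction s using Finset.induction_on generalizing k with
  | empty => cases k <;> simp [EE, powersetCard_empty_succ, coeff_one]
  | insert a s ha ih =>
    rw [Finset.prod_insert ha, add_mul, one_mul, mul_assoc, coeff_add, coeff_C_mul]
    cases k with
    | zero => simp [ih, EE_zero]
    | succ k => rw [coeff_X_mul, ih, ih, EE_insert _ _ ha]

lemma splits_deriv (p : ℝ[X]) (h : p.Splits) : p.derivative.Splits := by
  rw [splits_iff_card_roots] at *
  have h1 := card_roots_le_derivative p
  have h2 := natDegree_derivative_le p
  have h3 := card_roots' p.derivative
  omega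

lemma splits_iter (p : ℝ[X]) (h : p.Splits) (k : ℕ) : (derivative^[k] p).Splits := by
  induction k with
  | zero => simpa
  | succ k ih => rw [Function.iterate_succ_apply']; exact splits_deriv _ ih

lemma laguerre_roots (S : Multiset ℝ) (c t : ℝ) :
    let p : ℝ[X] := C c * (S.map (fun a => X - C a)).prod
    0 ≤ (p.derivative.eval t)^2 - p.eval t * p.derivative.derivative.eval t := by
  induction S using Multiset.induction_on with
  | empty => simp
  | cons a S ih =>
    intro p
    have hp : p = (X - C a) * (C c * (S.map (fun a => X - C a)).prod) := by
      simp only [p, Multiset.map_cons, Multiset.prod_cons]; ring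
    set q := (C c * (S.map (fun a => X - C a)).prod) with hq
    have hh : (p.derivative.eval t)^2 - p.eval t * p.derivative.derivative.eval t
       = (q.eval t)^2 + (t-a)^2 * ((q.derivative.eval t)^2 - q.eval t * q.derivative.derivative.eval t) := by
      rw [hp]; simp; ring
    rw [hh]
    have : 0 ≤ (q.derivative.eval t)^2 - q.eval t * q.derivative.derivative.eval t := ih
    positivity

lemma laguerre (p : ℝ[X]) (h : p.Splits) (t : ℝ) :
    0 ≤ (p.derivative.eval t)^2 - p.eval t * p.derivative.derivative.eval t := by
  have := laguerre_roots p.roots p.leadingCoeff t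
  rwa [← h.eq_prod_roots] at this

lemma newton {ι : Type*} (s : Finset ι) (x : ι → ℝ) (k : ℕ) :
    EE s x k * EE s x (k+2) ≤ EE s x (k+1)^2 := by
  set P : ℝ[X] := ∏ i ∈ s, (1 + C (x i) * X) with hP
  have hs : P.Splits := by
    apply Splits.prod
    intro i _
    apply Splits.of_natDegree_le_one
    compute_degree
  have h := laguerre _ (splits_iter P hs k) 0
  have key : ∀ j, (derivative^[j] P).eval 0 = (j.factorial : ℝ) * EE s x j := by
    intro j
    rw [← coeff_zero_eq_eval_zero, coeff_iterate_derivative, zero_add, Nat.descFactorial_self, coeff_gen]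
    simp
  rw [← Function.iterate_succ_apply' derivative, ← Function.iterate_succ_apply' derivative, key, key, key] at h
  simp only [Nat.succ_eq_add_one, Nat.factorial_succ] at h
  push_cast at h
  have hf : (0:ℝ) < (k.factorial : ℝ) := by positivity
  have h2 : 0 ≤ (k.factorial : ℝ)^2 * (k+1) * ((k+1) * EE s x (k+1)^2 - (k+2) * (EE s x k * EE s x (k+2))) := by
    have e : k + 1 + 1 = k + 2 := rfl
    rw [e] at h
    nlinarith [h]
  have h3 := nonneg_of_mul_nonneg_right h2 (by positivity)
  by_contra hc
  push Not at hc
  have hk : (0:ℝ) ≤ k := by positivity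
  nlinarith [sq_nonneg (EE s x (k+1))]

def GG {ι : Type*} (s : Finset ι) (x : ι → ℝ) (m : ℕ) : Prop := ∀ k ≤ m, 0 < EE s x k

lemma GG_erase {ι : Type*} [DecidableEq ι] (s : Finset ι) (i : ι) (hi : i ∈ s) (x : ι → ℝ) (m : ℕ)
    (h : GG s x (m+1)) : GG (s.erase i) x m := by
  intro k
  induction k with
  | zero => intro _; rw [EE_zero]; exact one_pos
  | succ k ih =>
    intro hk
    have ih := ih (by omega)
    have h1 := h (k+1) (by omega)
    have h2 := h (k+2) (by omega)
    rw [EE_erase s i hi] at h1 h2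
    have hN := newton (s.erase i) x k
    by_contra hc
    push Not at hc
    generalize EE (s.erase i) x k = a at *
    generalize EE (s.erase i) x (k+1) = b at *
    generalize EE (s.erase i) x (k+1+1) = c at *
    have h3 : 0 < (c + x i * b) * a := mul_pos h2 ih
    have h4 : 0 ≤ (b + x i * a) * (-b) := mul_nonneg h1.le (by linarith)
    change a * c ≤ b^2 at hN
    nlinarith

lemma frac_ineq (u u' v v' w : ℝ) (hv : 0 < v) (hv' : 0 < v') (hw : v + v' ≤ w) :
    (u+u')^2 / w ≤ u^2/v + u'^2/v' := by
  calc (u+u')^2 / w ≤ (u+u')^2/(v+v') := by gcongr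
    _ ≤ _ := by
      rw [div_add_div _ _ hv.ne' hv'.ne', div_le_div_iff₀ (by positivity) (by positivity)]
      nlinarith [mul_nonneg (mul_pos hv hv').le (sq_nonneg (u*v'-u'*v)), sq_nonneg (u*v'-u'*v)]

lemma phi_formula {ι : Type*} [DecidableEq ι] (s : Finset ι) (x : ι → ℝ) (m : ℕ)
    (h : GG s x (m+1)) :
    (m+2 : ℝ) * (EE s x (m+2) / EE s x (m+1)) =
      ∑ i ∈ s, (x i - x i ^2 / (x i + EE (s.erase i) x (m+1) / EE (s.erase i) x m)) := by
  have := EE_euler s x (m+1)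
  push_cast at this
  rw [← mul_div_assoc, show (m+2:ℝ) = m+1+1 by ring, ← this, Finset.sum_div]
  apply Finset.sum_congr rfl
  intro i hi
  have ha := GG_erase s i hi x m h m le_rfl
  have h1 := h (m+1) le_rfl
  rw [EE_erase s i hi] at h1 ⊢
  generalize EE (s.erase i) x m = a at *
  generalize EE (s.erase i) x (m+1) = b at *
  have : x i + b / a = (b + x i * a)/a := by field_simp; ring
  rw [this]
  field_simp
  ring

lemma main_super {ι : Type*} [DecidableEq ι] (m : ℕ) : ∀ (s : Finset ι) (x y : ι → ℝ),
    GG s x m → GG s y m → GG s (x+y) m ∧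
      EE s x (m+1) / EE s x m + EE s y (m+1) / EE s y m ≤ EE s (x+y) (m+1) / EE s (x+y) m := by
  induction m with
  | zero =>
    intro s x y hx hy
    refine ⟨fun k hk => ?_, ?_⟩
    · obtain rfl : k = 0 := by omega
      rw [EE_zero]; exact one_pos
    · simp [EE_zero, EE, Finset.powersetCard_one, Finset.sum_add_distrib]
  | succ m ih =>
    intro s x y hx hy
    have hx' : GG s x m := fun k hk => hx k (by omega)
    have hy' : GG s y m := fun k hk => hy k (by omega)
    obtain ⟨g, hg⟩ := ih s x y hx' hy'
    have hG : GG s (x+y) (m+1) := by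
      intro k hk
      rcases Nat.lt_or_ge k (m+1) with h | h
      · exact g k (by omega)
      · obtain rfl : k = m+1 := by omega
        have h1 := div_pos (hx (m+1) le_rfl) (hx m (by omega))
        have h2 := div_pos (hy (m+1) le_rfl) (hy m (by omega))
        exact (div_pos_iff_of_pos_right (g m le_rfl)).1 (by linarith)
    refine ⟨hG, ?_⟩
    have hm : (0:ℝ) < m + 2 := by positivity
    refine le_of_mul_le_mul_left ?_ hm
    change (m+2:ℝ) * (EE s x (m+2) / EE s x (m+1) + EE s y (m+2) / EE s y (m+1)) ≤
      (m+2:ℝ) * (EE s (x+y) (m+2) / EE s (x+y) (m+1))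
    rw [mul_add, phi_formula _ _ _ hx, phi_formula _ _ _ hy, phi_formula _ _ _ hG,
      ← Finset.sum_add_distrib]
    apply Finset.sum_le_sum
    intro i hi
    have pos : ∀ z : ι → ℝ, GG s z (m+1) →
        0 < z i + EE (s.erase i) z (m+1) / EE (s.erase i) z m := by
      intro z hz
      have ha := GG_erase s i hi z m hz m le_rfl
      have h1 := hz (m+1) le_rfl
      rw [EE_erase s i hi] at h1
      have : z i + EE (s.erase i) z (m+1) / EE (s.erase i) z m
        = (EE (s.erase i) z (m+1) + z i * EE (s.erase i) z m)/EE (s.erase i) z m := by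
        field_simp; ring
      rw [this]; exact div_pos h1 ha
    have h1 := (ih (s.erase i) x y (GG_erase s i hi x m hx) (GG_erase s i hi y m hy)).2
    have := frac_ineq (x i) (y i) _ _ ((x+y) i + EE (s.erase i) (x+y) (m+1) / EE (s.erase i) (x+y) m)
      (pos x hx) (pos y hy) (by rw [Pi.add_apply]; linarith)
    rw [Pi.add_apply] at *
    linarith

lemma EE_prod {ι : Type*} (s : Finset ι) (x : ι → ℝ) (m : ℕ) (h : GG s x m) :
    EE s x m = ∏ k ∈ Finset.range m, (EE s x (k+1) / EE s x k) := by
  induction m with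
  | zero => simp [EE_zero]
  | succ m ih =>
    have h' : GG s x m := fun k hk => h k (by omega)
    rw [Finset.prod_range_succ, ← ih h', mul_div_cancel₀ _ (h m (by omega)).ne']

lemma geom_super (m : ℕ) (hm : 1 ≤ m) (a b : ℕ → ℝ) (ha : ∀ k ∈ Finset.range m, 0 < a k)
    (hb : ∀ k ∈ Finset.range m, 0 < b k) :
    (∏ k ∈ Finset.range m, a k) ^ ((1:ℝ)/m) + (∏ k ∈ Finset.range m, b k) ^ ((1:ℝ)/m)
      ≤ (∏ k ∈ Finset.range m, (a k + b k)) ^ ((1:ℝ)/m) := by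
  have hm' : (0:ℝ) < m := by exact_mod_cast hm
  have hab : ∀ k ∈ Finset.range m, 0 < a k + b k := fun k hk => add_pos (ha k hk) (hb k hk)
  have hP : 0 < (∏ k ∈ Finset.range m, (a k + b k)) ^ ((1:ℝ)/m) :=
    Real.rpow_pos_of_pos (Finset.prod_pos hab) _
  have key : ∀ c : ℕ → ℝ, (∀ k ∈ Finset.range m, 0 < c k) →
      (∏ k ∈ Finset.range m, c k) ^ ((1:ℝ)/m) / (∏ k ∈ Finset.range m, (a k + b k)) ^ ((1:ℝ)/m)
       ≤ ∑ k ∈ Finset.range m, (1:ℝ)/m * (c k / (a k + b k)) := by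
    intro c hc
    have := Real.geom_mean_le_arith_mean_weighted (Finset.range m) (fun _ => (1:ℝ)/m)
      (fun k => c k / (a k + b k)) (fun _ _ => by positivity) (by simp; field_simp)
      (fun k hk => (div_pos (hc k hk) (hab k hk)).le)
    refine le_trans (le_of_eq ?_) this
    rw [Real.finsetProd_rpow _ _ (fun k hk => (div_pos (hc k hk) (hab k hk)).le), Finset.prod_div_distrib,
      Real.div_rpow (Finset.prod_pos hc).le (Finset.prod_pos hab).le]
  have h1 := add_le_add (key a ha) (key b hb)
  rw [← Finset.sum_add_distrib, ← add_div, div_le_iff₀ hP] at h1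
  have h2 : ∑ k ∈ Finset.range m, ((1:ℝ)/m * (a k / (a k + b k)) + (1:ℝ)/m * (b k / (a k + b k))) = 1 := by
    have : ∀ k ∈ Finset.range m, ((1:ℝ)/m * (a k / (a k + b k)) + (1:ℝ)/m * (b k / (a k + b k))) = 1/m := by
      intro k hk
      rw [← mul_add, ← add_div, div_self (hab k hk).ne', mul_one]
    rw [Finset.sum_congr rfl this]; simp; field_simp
  rwa [h2, one_mul] at h1

lemma root_super {ι : Type*} (s : Finset ι) (x y : ι → ℝ) (m : ℕ) (hm : 1 ≤ m)
    (hx : GG s x m) (hy : GG s y m) :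
    EE s x m ^ ((1:ℝ)/m) + EE s y m ^ ((1:ℝ)/m) ≤ EE s (x+y) m ^ ((1:ℝ)/m) := by
  classical
  have hG := (main_super m s x y hx hy).1
  rw [EE_prod s x m hx, EE_prod s y m hy, EE_prod s _ m hG]
  have p : ∀ z : ι → ℝ, GG s z m → ∀ k ∈ Finset.range m, 0 < EE s z (k+1) / EE s z k := by
    intro z hz k hk
    have := Finset.mem_range.1 hk
    exact div_pos (hz _ (by omega)) (hz _ (by omega))
  refine (geom_super m hm _ _ (p x hx) (p y hy)).trans ?_
  apply Real.rpow_le_rpow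
  · exact Finset.prod_nonneg fun k hk => (add_pos (p x hx k hk) (p y hy k hk)).le
  · apply Finset.prod_le_prod
    · exact fun k hk => (add_pos (p x hx k hk) (p y hy k hk)).le
    · intro k hk
      have := Finset.mem_range.1 hk
      exact (main_super k s x y (fun j hj => hx j (by omega)) (fun j hj => hy j (by omega))).2
  · positivity

lemma EE_smul {ι : Type*} (s : Finset ι) (x : ι → ℝ) (t : ℝ) (k : ℕ) :
    EE s (t • x) k = t ^ k * EE s x k := by
  unfold EE
  rw [Finset.mul_sum]
  apply Finset.sum_congr rfl
  intro S hS
  simp [Finset.prod_mul_distrib, (Finset.mem_powersetCard.1 hS).2]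

lemma coeff_pow_nonneg (ε : ℝ) (hε : 0 < ε) (n j : ℕ) : 0 ≤ ((1 + C ε * X : ℝ[X])^n).coeff j := by
  have h := coeff_gen (Finset.range n) (fun _ => ε) j
  simp only [Finset.prod_const, Finset.card_range] at h
  rw [h]
  exact Finset.sum_nonneg fun S _ => Finset.prod_nonneg fun _ _ => hε.le

lemma coeff_pow_pos (ε : ℝ) (hε : 0 < ε) (n j : ℕ) (hj : j ≤ n) : 0 < ((1 + C ε * X : ℝ[X])^n).coeff j := by
  have h := coeff_gen (Finset.range n) (fun _ => ε) j
  simp only [Finset.prod_const, Finset.card_range] at h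
  rw [h]
  refine Finset.sum_pos (fun S _ => Finset.prod_pos fun _ _ => hε) ?_
  rw [Finset.powersetCard_nonempty]; simpa

lemma GG_shift {ι : Type*} (s : Finset ι) (x : ι → ℝ) (m : ℕ) (hms : m ≤ s.card) (ε : ℝ) (hε : 0 < ε)
    (hx : ∀ k, 1 ≤ k → k ≤ m → 0 ≤ EE s x k) : GG s (x + fun _ => ε) m := by
  classical
  intro k hk
  have h1 : (∏ i ∈ s, (1 + C ((x + fun _ => ε : ι → ℝ) i) * X) : ℝ[X]) =
      ∑ j ∈ Finset.range (s.card + 1), C (EE s x j) * ((1 + C ε * X)^(s.card - j) * X^j) := by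
    have : (∏ i ∈ s, (1 + C ((x + fun _ => ε : ι → ℝ) i) * X) : ℝ[X]) = ∏ i ∈ s, (C (x i) * X + (1 + C ε * X)) := by
      apply Finset.prod_congr rfl
      intro i _
      simp only [Pi.add_apply, C_add]; ring
    rw [this, Finset.prod_add, Finset.sum_powerset]
    apply Finset.sum_congr rfl
    intro j _
    unfold EE
    rw [map_sum, Finset.sum_mul]
    apply Finset.sum_congr rfl
    intro S hS
    have hS := Finset.mem_powersetCard.1 hS
    rw [Finset.prod_mul_distrib, Finset.prod_const, Finset.prod_const, Finset.card_sdiff_of_subset hS.1, hS.2,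
      map_prod]
    ring
  rw [← coeff_gen, h1, finset_sum_coeff]
  apply Finset.sum_pos'
  · intro j _
    rw [coeff_C_mul, coeff_mul_X_pow']
    split_ifs with h
    · refine mul_nonneg ?_ (coeff_pow_nonneg ε hε _ _)
      rcases Nat.eq_zero_or_pos j with rfl | h0
      · rw [EE_zero]; exact zero_le_one
      · exact hx j h0 (by omega)
    · simp
  · refine ⟨0, by simp, ?_⟩
    rw [EE_zero]
    simpa using coeff_pow_pos ε hε s.card k (by omega)

lemma EE_cont {ι : Type*} (s : Finset ι) (x : ι → ℝ) (m : ℕ) :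
    Continuous fun ε : ℝ => EE s (x + fun _ => ε) m ^ ((1:ℝ)/m) := by
  apply Continuous.rpow_const
  · unfold EE
    simp only [Pi.add_apply]
    fun_prop
  · intro _; right; positivity

lemma root_conc_open {ι : Type*} (s : Finset ι) (x y : ι → ℝ) (m : ℕ) (hm : 1 ≤ m)
    (hx : GG s x m) (hy : GG s y m) (t : ℝ) (ht0 : 0 < t) (ht1 : 0 < 1 - t) :
    t * EE s x m ^ ((1:ℝ)/m) + (1 - t) * EE s y m ^ ((1:ℝ)/m)
      ≤ EE s (t • x + (1-t) • y) m ^ ((1:ℝ)/m) := by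
  have g : ∀ (z : ι → ℝ) (r : ℝ), 0 < r → GG s z m → GG s (r • z) m := by
    intro z r hr hz k hk
    rw [EE_smul]; exact mul_pos (pow_pos hr _) (hz k hk)
  have e : ∀ (z : ι → ℝ) (r : ℝ), 0 < r → GG s z m →
      EE s (r • z) m ^ ((1:ℝ)/m) = r * EE s z m ^ ((1:ℝ)/m) := by
    intro z r hr hz
    rw [EE_smul, Real.mul_rpow (by positivity) (hz m le_rfl).le, one_div,
      Real.pow_rpow_inv_natCast hr.le (by omega)]
  have := root_super s _ _ m hm (g x t ht0 hx) (g y _ ht1 hy)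
  rwa [e x t ht0 hx, e y _ ht1 hy] at this

/-- Concavity of `e_m^{1/m}` on the closed Gårding cone: if `x, y ∈ ℝⁿ` satisfy
`e_k(x) ≥ 0` and `e_k(y) ≥ 0` for every `k = 1,…,m`, then for every `t ∈ [0,1]`,
`e_m(t·x + (1−t)·y)^{1/m} ≥ t e_m(x)^{1/m} + (1−t) e_m(y)^{1/m}`. -/
theorem esymm_root_concave {n m : ℕ} (hn : 1 ≤ n) (hm : 1 ≤ m) (hmn : m ≤ n)
    (x y : Fin n → ℝ)
    (hx : ∀ k, 1 ≤ k → k ≤ m → 0 ≤ esymm x k)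
    (hy : ∀ k, 1 ≤ k → k ≤ m → 0 ≤ esymm y k)
    (t : ℝ) (ht0 : 0 ≤ t) (ht1 : t ≤ 1) :
    esymm (t • x + (1 - t) • y) m ^ ((1 : ℝ) / m)
      ≥ t * esymm x m ^ ((1 : ℝ) / m) + (1 - t) * esymm y m ^ ((1 : ℝ) / m) := by
  rcases ht0.eq_or_lt with rfl | ht0
  · simp
  rcases ht1.eq_or_lt with rfl | ht1
  · simp
  have h : ∀ ε : ℝ, 0 < ε →
      t * EE Finset.univ (x + fun _ => ε) m ^ ((1:ℝ)/m)
        + (1 - t) * EE Finset.univ (y + fun _ => ε) m ^ ((1:ℝ)/m)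
      ≤ EE Finset.univ ((t • x + (1-t) • y) + fun _ => ε) m ^ ((1:ℝ)/m) := by
    intro ε hε
    have h := root_conc_open Finset.univ _ _ m hm
      (GG_shift Finset.univ x m (by simpa) ε hε hx) (GG_shift Finset.univ y m (by simpa) ε hε hy)
      t ht0 (by linarith)
    have e : t • (x + fun _ => ε) + (1-t) • (y + fun _ => ε) = (t • x + (1-t) • y) + fun _ => ε := by
      ext i; simp; ring
    rwa [e] at h
  have c : ∀ z : Fin n → ℝ, Filter.Tendsto
      (fun ε : ℝ => EE Finset.univ (z + fun _ => ε) m ^ ((1:ℝ)/m)) (nhdsWithin 0 (Set.Ioi 0))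
      (nhds (esymm z m ^ ((1:ℝ)/m))) := by
    intro z
    have := ((EE_cont Finset.univ z m).tendsto 0).mono_left
      (nhdsWithin_le_nhds (s := Set.Ioi (0:ℝ)))
    have e : (z + fun _ => (0:ℝ)) = z := by ext i; simp
    rw [e] at this
    exact this
  refine le_of_tendsto_of_tendsto (((c x).const_mul t).add ((c y).const_mul (1-t))) (c _) ?_
  filter_upwards [self_mem_nhdsWithin] with ε hε
  exact h ε hε
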